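/- Assume T > R > P > S, 2R > T + S, 0 ≤ γ < 1 and γ² > (T−R)/(R−P). Let n ≥ 2 and let τ : (Fin n → Ω) → {C,D} be the memory-n retarded WSLS strategy: τ h = C if h 1 ∈ {(C,C),(D,D)} and τ h = D otherwise. Then there exists Q : {C,D} × (Fin n → Ω) → ℝ satisfying the player-1 memory-n Bellman optimality equation against τ such that for every history h: if h 1 ∈ {(C,C),(D,D)} then Q(C,h) > Q(D,h), and otherwise Q(D,h) > Q(C,h); that is, a pair of retarded WSLS strategies remains a symmetric mutual reinforcement learning equilibrium under memory-n reinforcement learning for every n ≥ 2. -/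

import Mathlib

inductive Act where
  | C : Act
  | D : Act
deriving DecidableEq

open Act

abbrev St : Type := Act × Act

/-- Player 1's payoff in the prisoner's dilemma. -/
def r1 (R S T P : ℝ) : Act → Act → ℝ
  | C, C => R
  | C, D => S
  | D, C => T
  | D, D => P

/-- Prepend the new state `(σ, σ2)` to a memory-`n` history, discarding the oldest state. -/
def push {n : ℕ} (σ σ2 : Act) (h : Fin n → St) : Fin n → St := fun i =>
  if (i : ℕ) = 0 then (σ, σ2)
  else h ⟨(i : ℕ) - 1, Nat.lt_of_le_of_lt (Nat.sub_le _ _) i.isLt⟩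

/-- Restrict a memory-`n` history to its `n'` most recent states (`n' ≤ n`). -/
def restrict {n n' : ℕ} (hle : n' ≤ n) (h : Fin n → St) : Fin n' → St := fun i =>
  h ⟨(i : ℕ), Nat.lt_of_lt_of_le i.isLt hle⟩

/-- the memory-`n` retarded WSLS strategy (cooperate iff the second-to-last
state was `(C,C)` or `(D,D)`) forms a symmetric mutual reinforcement learning equilibrium under
memory-`n` reinforcement learning, for every `n ≥ 2`, when `γ² > (T−R)/(R−P)`. -/
theorem stmt_16 (R S T P γ : ℝ) (hTR : T > R) (hRP : R > P) (hPS : P > S)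
    (h2R : 2 * R > T + S) (hγ0 : 0 ≤ γ) (hγ1 : γ < 1)
    (hγ2 : γ ^ 2 > (T - R) / (R - P))
    (n : ℕ) (hn : 2 ≤ n)
    (τ : (Fin n → St) → Act)
    (hτ : ∀ h : Fin n → St,
      τ h = if h ⟨1, hn⟩ = (C, C) ∨ h ⟨1, hn⟩ = (D, D) then C else D) :
    ∃ Q : Act → (Fin n → St) → ℝ,
      (∀ σ (h : Fin n → St), Q σ h =
        r1 R S T P σ (τ h) +
          γ * max (Q C (push σ (τ h) h)) (Q D (push σ (τ h) h))) ∧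
      (∀ h : Fin n → St,
        (h ⟨1, hn⟩ = (C, C) ∨ h ⟨1, hn⟩ = (D, D) → Q C h > Q D h) ∧
        (¬(h ⟨1, hn⟩ = (C, C) ∨ h ⟨1, hn⟩ = (D, D)) → Q D h > Q C h)) := by
  have hgap : 0 < R - T + γ ^ 2 * (R - P) := by
    have := (div_lt_iff₀ (sub_pos.2 hRP)).1 hγ2
    linarith
  obtain ⟨v, hv⟩ : ∃ v : ℝ, v = R + γ * v :=
    ⟨R / (1 - γ), by have : 1 - γ ≠ 0 := by linarith
                     field_simp; ring⟩
  obtain ⟨f, hf⟩ : ∃ f : St → ℝ, ∀ s, f s = if s = (C, C) ∨ s = (D, D) then R else P :=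
    ⟨_, fun _ => rfl⟩
  obtain ⟨V, hV⟩ : ∃ V : (Fin n → St) → ℝ,
      ∀ h, V h = f (h ⟨1, hn⟩) + γ * f (h ⟨0, by lia⟩) + γ ^ 2 * v := ⟨_, fun _ => rfl⟩
  obtain ⟨Q, hQ⟩ : ∃ Q : Act → (Fin n → St) → ℝ,
      ∀ σ h, Q σ h = r1 R S T P σ (τ h) + γ * V (push σ (τ h) h) := ⟨_, fun _ _ => rfl⟩
  have hVpush (σ σ2 : Act) (h : Fin n → St) :
      V (push σ σ2 h) = f (h ⟨0, by lia⟩) + γ * f (σ, σ2) + γ ^ 2 * v := by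
    simp [hV, push]
  have hgood (h : Fin n → St) (hg : h ⟨1, hn⟩ = (C, C) ∨ h ⟨1, hn⟩ = (D, D)) :
      Q C h = V h ∧ Q D h < Q C h := by
    have ht : τ h = C := by rw [hτ, if_pos hg]
    have h1 : f (h ⟨1, hn⟩) = R := by rw [hf, if_pos hg]
    have hC : f (C, C) = R := by simp [hf]
    have hD : f (D, C) = P := by simp [hf]
    simp only [hQ, ht, hVpush, hC, hD, r1]
    refine ⟨?_, by nlinarith⟩
    rw [hV, h1]
    linear_combination -γ ^ 2 * hv
  have hbad (h : Fin n → St) (hb : ¬(h ⟨1, hn⟩ = (C, C) ∨ h ⟨1, hn⟩ = (D, D))) :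
      Q D h = V h ∧ Q C h < Q D h := by
    have ht : τ h = D := by rw [hτ, if_neg hb]
    have h1 : f (h ⟨1, hn⟩) = P := by rw [hf, if_neg hb]
    have hC : f (C, D) = P := by simp [hf]
    have hD : f (D, D) = R := by simp [hf]
    simp only [hQ, ht, hVpush, hC, hD, r1]
    refine ⟨?_, by nlinarith [mul_nonneg (sq_nonneg γ) (sub_pos.2 hRP).le]⟩
    rw [hV, h1]
    linear_combination -γ ^ 2 * hv
  have hmax (h : Fin n → St) : max (Q C h) (Q D h) = V h := by
    by_cases hg : h ⟨1, hn⟩ = (C, C) ∨ h ⟨1, hn⟩ = (D, D)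
    · rw [max_eq_left (hgood h hg).2.le, (hgood h hg).1]
    · rw [max_eq_right (hbad h hg).2.le, (hbad h hg).1]
  exact ⟨Q, fun σ h => by rw [hmax, hQ],
    fun h => ⟨fun hg => (hgood h hg).2, fun hb => (hbad h hb).2⟩⟩
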